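/- If G is a minimal counterexample, then G has at least 10 vertices; equivalently, every finite simple graph with maximum degree at most 3 on at most 9 vertices admits a good coloring. -/

import Mathlib

open SimpleGraph

/-- A `(1,2^k)`-packing edge-coloring encoded as a function assigning a color in
`Fin (k+1)` to each unordered pair. Color `0` is the 1-color (its class must be a
matching) and each color `i ≠ 0` is a 2-color (its class must be an induced matching). -/
def IsPackingEC {V : Type} (G : SimpleGraph V) (k : ℕ)
    (c : Sym2 V → Fin (k + 1)) : Prop :=
  (∀ a b x y : V, G.Adj a b → G.Adj x y → s(a, b) ≠ s(x, y) →
      c s(a, b) = 0 → c s(x, y) = 0 →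
      a ≠ x ∧ a ≠ y ∧ b ≠ x ∧ b ≠ y) ∧
  ∀ a b x y : V, G.Adj a b → G.Adj x y → s(a, b) ≠ s(x, y) →
      c s(a, b) = c s(x, y) → c s(a, b) ≠ 0 →
      (a ≠ x ∧ a ≠ y ∧ b ≠ x ∧ b ≠ y) ∧
      ¬G.Adj a x ∧ ¬G.Adj a y ∧ ¬G.Adj b x ∧ ¬G.Adj b y

/-- A good coloring: a `(1,2^7)`-packing edge-coloring in which every edge of the
1-color class (color `0`) has both endpoints of degree 3. -/
def GoodColoring {V : Type} (G : SimpleGraph V) (c : Sym2 V → Fin 8) : Prop :=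
  IsPackingEC G 7 c ∧
  ∀ a b : V, G.Adj a b → c s(a, b) = 0 →
    (G.neighborSet a).ncard = 3 ∧ (G.neighborSet b).ncard = 3

/-- A graph is subcubic if every vertex has degree at most 3. -/
def Subcubic {V : Type} (G : SimpleGraph V) : Prop :=
  ∀ v : V, (G.neighborSet v).ncard ≤ 3

/-- A minimal counterexample: a finite subcubic simple graph with no good coloring such
that every finite subcubic simple graph with smaller `|V| + |E|` has a good coloring. -/
def MinCounter (V : Type) [Finite V] (G : SimpleGraph V) : Prop :=
  Subcubic G ∧
  (¬∃ c : Sym2 V → Fin 8, GoodColoring G c) ∧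
  ∀ (W : Type) [Finite W] (H : SimpleGraph W), Subcubic H →
    Nat.card W + H.edgeSet.ncard < Nat.card V + G.edgeSet.ncard →
    ∃ c : Sym2 W → Fin 8, GoodColoring H c

namespace SmallSubcubic

/-! ### An exhaustive search over small subcubic graphs

A graph on vertices `0, …, 8` is stored as a list `E` of pairs `a < b` and as its adjacency
matrix `M`, a natural number whose bit `9 * a + b` records whether `a` and `b` are adjacent. The
functions below are written with raw recursors and `Nat` operations so that the kernel evaluates
them quickly. -/

/-- The set of neighbors of `a`, as a bit mask. -/
def row (M a : ℕ) : ℕ := Nat.mod (Nat.shiftRight M (Nat.mul 9 a)) 512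

/-- The number of set bits of a nine-bit number. -/
def bits (r : ℕ) : ℕ := Nat.mod (Nat.land (Nat.mul r 0x200040008001) 0x111111111111111) 15

/-- The matrix with a single entry at `(a, b)`. -/
def cell (a b : ℕ) : ℕ := Nat.pow 2 (Nat.add (Nat.mul 9 a) b)

/-- Add the edge `ab` to the adjacency matrix `M`. -/
def addEdge (a b M : ℕ) : ℕ := Nat.lor M (Nat.lor (cell a b) (cell b a))

/-- Try to put an edge with vertex mask `m` and neighborhood mask `n` into a class with offset in
`l`, where `S` records the vertices forbidden in each class, and go on with `g`. Offsets after the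
first empty class are skipped. -/
noncomputable def place (g : ℕ → Bool) (S m n : ℕ) (l : List ℕ) : Bool :=
  List.rec false
    (fun s _ ih =>
      (bif Nat.beq (Nat.land S (Nat.shiftLeft m s)) 0 then g (Nat.lor S (Nat.shiftLeft n s))
        else false) ||
      (Nat.ble (Nat.shiftLeft 1 s) S && ih)) l

/-- Backtracking search for a coloring of the edges in `E`. Bit `9 * j + v` of the last argument
tells whether the vertex `v` is forbidden for the edges of color `j`. -/
noncomputable def colorable (M : ℕ) (E : List (ℕ × ℕ)) : ℕ → Bool :=
  List.rec (fun _ => true)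
    (fun e _ ih S =>
      (Nat.beq (Nat.land S (Nat.lor (Nat.pow 2 e.1) (Nat.pow 2 e.2))) 0 &&
        ih (Nat.lor S (Nat.lor (Nat.pow 2 e.1) (Nat.pow 2 e.2)))) ||
      place ih S (Nat.lor (Nat.pow 2 e.1) (Nat.pow 2 e.2)) (Nat.lor (row M e.1) (row M e.2))
        [9, 18, 27, 36, 45, 54, 63]) E

/-- The set of vertices in `l` of degree less than three, as a bit mask. -/
noncomputable def lowDegree (M : ℕ) (l : List ℕ) : ℕ :=
  List.rec 0
    (fun a _ S => bif Nat.ble 3 (bits (row M a)) then S else Nat.lor S (Nat.pow 2 a)) l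

/-- Search through all subcubic graphs on at most nine vertices without vertices of degree at most
one, in the order of a breadth-first exploration, checking that each of them is colorable. In the
current state `n` vertices have been discovered, all the neighbors of the vertices before `i` are
known, and so are the neighbors of `i` before `j`. -/
noncomputable def search (k : ℕ) : ℕ → ℕ → ℕ → List (ℕ × ℕ) → ℕ → Bool :=
  Nat.rec (fun _ _ _ _ _ => false)
    (fun _ ih n i j E M =>
      bif Nat.beq i n then
        colorable M E (lowDegree M [0, 1, 2, 3, 4, 5, 6, 7, 8]) &&
          (Nat.ble 9 n || ih (Nat.succ n) i (Nat.succ n) E M)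
      else bif Nat.beq j n then
        (Nat.ble (bits (row M i)) 1 || ih n (Nat.succ i) (Nat.succ (Nat.succ i)) E M) &&
          (Nat.ble 9 n || (Nat.ble 3 (bits (row M i)) ||
            ih (Nat.succ n) i (Nat.succ n) ((i, n) :: E) (addEdge i n M)))
      else
        ih n i (Nat.succ j) E M &&
          (Nat.ble 3 (bits (row M i)) || (Nat.ble 3 (bits (row M j)) ||
            ih n i (Nat.succ j) ((i, j) :: E) (addEdge i j M)))) k

theorem search_eq_true : search 100 0 0 1 [] 0 = true := by
  decide +kernel

/-- The adjacency matrix of a list of edges. -/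
def matrix : List (ℕ × ℕ) → ℕ
  | [] => 0
  | e :: E => addEdge e.1 e.2 (matrix E)

theorem addEdge_eq (a b M : ℕ) :
    addEdge a b M = M ||| (2 ^ (9 * a + b) ||| 2 ^ (9 * b + a)) := rfl

theorem row_eq (M a : ℕ) : row M a = (M >>> (9 * a)) % 2 ^ 9 := rfl

theorem testBit_matrix {E : List (ℕ × ℕ)} (hE : ∀ e ∈ E, e.1 < 9 ∧ e.2 < 9) {a b : ℕ}
    (hb : b < 9) :
    (matrix E).testBit (9 * a + b) = true ↔ (a, b) ∈ E ∨ (b, a) ∈ E := by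
  induction E with
  | nil => simp [matrix]
  | cons e E ih =>
    obtain ⟨x, y⟩ := e
    have hxy := hE (x, y) (by simp)
    have ih := ih fun e he => hE e (List.mem_cons_of_mem _ he)
    simp only [matrix, addEdge_eq, Nat.testBit_or, Bool.or_eq_true, ih, Nat.testBit_two_pow, decide_eq_true_eq,
      List.mem_cons, Prod.mk.injEq]
    have h1 : 9 * x + y = 9 * a + b ↔ a = x ∧ b = y := by omega
    have h2 : 9 * y + x = 9 * a + b ↔ b = x ∧ a = y := by omega
    rw [h1, h2]
    grind

theorem testBit_row {E : List (ℕ × ℕ)} (hE : ∀ e ∈ E, e.1 < 9 ∧ e.2 < 9) {a b : ℕ}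
    (hb : b < 9) :
    (row (matrix E) a).testBit b = true ↔ (a, b) ∈ E ∨ (b, a) ∈ E := by
  rw [← testBit_matrix hE hb, row_eq, Nat.testBit_mod_two_pow, Nat.testBit_shiftRight]
  simp [hb]

theorem bits_row (M a : ℕ) :
    bits (row M a) = ((Finset.range 9).filter fun b => (row M a).testBit b = true).card := by
  have key : ∀ r < 512,
      bits r = ((Finset.range 9).filter fun b => r.testBit b = true).card := by
    decide +kernel
  exact key _ (Nat.mod_lt _ (by norm_num))

theorem three_le_bits_of_not_testBit_lowDegree {M a : ℕ} {l : List ℕ} (ha : a ∈ l)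
    (h : (lowDegree M l).testBit a = false) : 3 ≤ bits (row M a) := by
  induction l with
  | nil => simp at ha
  | cons b l ih =>
    change (bif Nat.ble 3 (bits (row M b)) then lowDegree M l
      else lowDegree M l ||| 2 ^ b).testBit a = false at h
    cases hb : Nat.ble 3 (bits (row M b)) with
    | false =>
      simp only [hb, cond_false, Nat.testBit_or, Bool.or_eq_false_iff, Nat.testBit_two_pow,
        decide_eq_false_iff_not] at h
      rcases List.mem_cons.1 ha with rfl | ha
      · exact absurd rfl h.2
      · exact ih ha h.1
    | true =>
      simp only [hb, cond_true] at h
      rcases List.mem_cons.1 ha with rfl | ha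
      · exact Nat.le_of_ble_eq_true hb
      · exact ih ha h

theorem exists_of_place {g : ℕ → Bool} {S m n : ℕ} {l : List ℕ} (h : place g S m n l = true) :
    ∃ s ∈ l, S &&& m <<< s = 0 ∧ g (S ||| n <<< s) = true := by
  induction l with
  | nil => exact absurd h Bool.false_ne_true
  | cons s l ih =>
    change ((bif Nat.beq (S &&& m <<< s) 0 then g (S ||| n <<< s) else false) ||
      (Nat.ble (1 <<< s) S && place g S m n l)) = true at h
    rw [Bool.or_eq_true, Bool.and_eq_true] at h
    rcases h with h | ⟨-, h⟩
    · cases hs : Nat.beq (S &&& m <<< s) 0 with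
      | false => simp [hs] at h
      | true => exact ⟨s, by simp, Nat.eq_of_beq_eq_true hs, by simpa [hs] using h⟩
    · obtain ⟨t, ht, h⟩ := ih h
      exact ⟨t, List.mem_cons_of_mem _ ht, h⟩

/-- The vertices forbidden for the edges that get the same color `j` as the edge `e`. -/
def forbidden (M j : ℕ) (e : ℕ × ℕ) : ℕ :=
  if j = 0 then 2 ^ e.1 ||| 2 ^ e.2 else row M e.1 ||| row M e.2

theorem exists_of_colorable_cons {M S : ℕ} {e : ℕ × ℕ} {E : List (ℕ × ℕ)}
    (h : colorable M (e :: E) S = true) :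
    ∃ j < 8, S &&& (2 ^ e.1 ||| 2 ^ e.2) <<< (9 * j) = 0 ∧
      colorable M E (S ||| forbidden M j e <<< (9 * j)) = true := by
  change ((Nat.beq (S &&& (2 ^ e.1 ||| 2 ^ e.2)) 0 &&
    colorable M E (S ||| (2 ^ e.1 ||| 2 ^ e.2))) ||
      place (colorable M E) S (2 ^ e.1 ||| 2 ^ e.2) (row M e.1 ||| row M e.2)
        [9, 18, 27, 36, 45, 54, 63]) = true at h
  rw [Bool.or_eq_true, Bool.and_eq_true] at h
  rcases h with ⟨h0, h⟩ | h
  · exact ⟨0, by norm_num, by simpa using Nat.eq_of_beq_eq_true h0, by simpa [forbidden] using h⟩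
  · obtain ⟨s, hs, h0, h⟩ := exists_of_place h
    have : ∃ j, j < 8 ∧ j ≠ 0 ∧ s = 9 * j := by
      refine ⟨s / 9, ?_⟩
      simp only [List.mem_cons, List.not_mem_nil, or_false] at hs
      omega
    obtain ⟨j, hj, hj0, rfl⟩ := this
    exact ⟨j, hj, h0, by simpa [forbidden, hj0] using h⟩

theorem exists_coloring_of_colorable {M : ℕ} {E : List (ℕ × ℕ)} {S : ℕ} (hE : E.Nodup)
    (h : colorable M E S = true) :
    ∃ c : ℕ × ℕ → ℕ,
      (∀ e ∈ E, c e < 8 ∧ S.testBit (9 * c e + e.1) = false ∧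
        S.testBit (9 * c e + e.2) = false) ∧
      E.Pairwise fun e e' => c e = c e' → (forbidden M (c e) e).testBit e'.1 = false ∧
        (forbidden M (c e) e).testBit e'.2 = false := by
  induction E generalizing S with
  | nil => exact ⟨fun _ => 0, by simp⟩
  | cons e E ih =>
    obtain ⟨heE, hE⟩ := List.nodup_cons.1 hE
    obtain ⟨j, hj, h0, h⟩ := exists_of_colorable_cons h
    obtain ⟨c, hc, hp⟩ := ih hE h
    have hne : ∀ e' ∈ E, e' ≠ e := fun e' he' h => heE (h ▸ he')
    have hS (v : ℕ) (hv : v = e.1 ∨ v = e.2) : S.testBit (9 * j + v) = false := by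
      have := congrArg (Nat.testBit · (9 * j + v)) h0
      rcases hv with rfl | rfl <;> simpa [Nat.testBit_and, Nat.testBit_shiftLeft] using this
    refine ⟨Function.update c e j, ?_, ?_⟩
    · intro e' he'
      rcases List.mem_cons.1 he' with rfl | he'
      · simpa using ⟨hj, hS _ (.inl rfl), hS _ (.inr rfl)⟩
      · have := hc e' he'
        simp only [Nat.testBit_or, Bool.or_eq_false_iff] at this
        rw [Function.update_of_ne (hne e' he')]
        exact ⟨this.1, this.2.1.1, this.2.2.1⟩
    · refine List.pairwise_cons.2 ⟨fun e' he' => ?_, hp.imp_of_mem fun {a b} ha hb hab => ?_⟩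
      · rw [Function.update_of_ne (hne e' he'), Function.update_self]
        rintro rfl
        have := hc e' he'
        simp only [Nat.testBit_or, Bool.or_eq_false_iff, Nat.testBit_shiftLeft] at this
        exact ⟨by simpa using this.2.1.2, by simpa using this.2.2.2⟩
      · rwa [Function.update_of_ne (hne a ha), Function.update_of_ne (hne b hb)]

variable {V : Type} {G : SimpleGraph V} {f : ℕ → V} {n i j : ℕ} {E : List (ℕ × ℕ)}

/-- The vertices `f 0, …, f (n - 1)` of `G` are distinct and not isolated, all the neighbors of the
first `i` of them are among them, and `E` lists the edges inside this set that have an end before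
`i` or join `i` to a vertex before `j`. -/
structure Explored (G : SimpleGraph V) (f : ℕ → V) (n i j : ℕ) (E : List (ℕ × ℕ)) : Prop where
  injOn : Set.InjOn f (Set.Iio n)
  le : i ≤ n
  lt : i < j
  le_of_lt : i < n → j ≤ n
  nodup : E.Nodup
  mem_iff : ∀ a b, (a, b) ∈ E ↔
    a < b ∧ b < n ∧ (a < i ∨ a = i ∧ b < j) ∧ G.Adj (f a) (f b)
  closed : ∀ a < i, ∀ w, G.Adj (f a) w → ∃ b < n, f b = w
  exists_adj : ∀ a < n, ∃ w, G.Adj (f a) w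

theorem le_card_of_injOn [Finite V] (hf : Set.InjOn f (Set.Iio n)) : n ≤ Nat.card V := by
  have h := Set.ncard_le_card (f '' Set.Iio n)
  rwa [hf.ncard_image, Set.ncard_Iio_nat] at h

theorem injOn_update {w : V} (hf : Set.InjOn f (Set.Iio n)) (hw : ∀ b < n, f b ≠ w) :
    Set.InjOn (Function.update f n w) (Set.Iio (n + 1)) := by
  intro a ha b hb hab
  simp only [Set.mem_Iio] at ha hb
  rcases eq_or_ne a n with han | han <;> rcases eq_or_ne b n with hbn | hbn
  · rw [han, hbn]
  · rw [han, Function.update_self, Function.update_of_ne hbn] at hab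
    exact absurd hab.symm (hw b (by omega))
  · rw [hbn, Function.update_self, Function.update_of_ne han] at hab
    exact absurd hab (hw a (by omega))
  · rw [Function.update_of_ne han, Function.update_of_ne hbn] at hab
    exact hf (Set.mem_Iio.2 (by omega)) (Set.mem_Iio.2 (by omega)) hab

namespace Explored

theorem lt_of_mem (h : Explored G f n i j E) (hn : n ≤ 9) :
    ∀ e ∈ E, e.1 < 9 ∧ e.2 < 9 := by
  intro e he
  have := (h.mem_iff e.1 e.2).1 he
  omega

theorem testBit_row_iff (h : Explored G f n i j E) (hn : n ≤ 9) {a b : ℕ} (hb : b < 9) :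
    (row (matrix E) a).testBit b = true ↔ (a, b) ∈ E ∨ (b, a) ∈ E :=
  testBit_row (h.lt_of_mem hn) hb

theorem bits_eq_ncard (h : Explored G f n i j E) (hn : n ≤ 9) (a : ℕ) :
    bits (row (matrix E) a) = (f '' {b | (a, b) ∈ E ∨ (b, a) ∈ E}).ncard := by
  have hlt : ∀ b, (a, b) ∈ E ∨ (b, a) ∈ E → b < n := by
    intro b hb
    have h1 := h.mem_iff a b
    have h2 := h.mem_iff b a
    rcases hb with hb | hb
    · exact (h1.1 hb).2.1
    · have := h2.1 hb
      omega
  have hinj : Set.InjOn f {b | (a, b) ∈ E ∨ (b, a) ∈ E} := h.injOn.mono fun b => hlt b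
  rw [hinj.ncard_image, bits_row, ← Set.ncard_coe_finset]
  congr 1
  ext b
  simp only [Finset.coe_filter, Finset.mem_range, Set.mem_ofPred_eq]
  constructor
  · rintro ⟨hb, hb'⟩
    exact (h.testBit_row_iff hn hb).1 hb'
  · intro hb
    have hb9 : b < 9 := (hlt b hb).trans_le hn
    exact ⟨hb9, (h.testBit_row_iff hn hb9).2 hb⟩

theorem image_subset (h : Explored G f n i j E) (a : ℕ) :
    f '' {b | (a, b) ∈ E ∨ (b, a) ∈ E} ⊆ G.neighborSet (f a) := by
  rintro _ ⟨b, hb | hb, rfl⟩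
  · exact ((h.mem_iff a b).1 hb).2.2.2
  · exact ((h.mem_iff b a).1 hb).2.2.2.symm

theorem bits_le_ncard [Finite V] (h : Explored G f n i j E) (hn : n ≤ 9) (a : ℕ) :
    bits (row (matrix E) a) ≤ (G.neighborSet (f a)).ncard := by
  rw [h.bits_eq_ncard hn]
  exact Set.ncard_le_ncard (h.image_subset a)

theorem bits_lt_of_adj [Finite V] (h : Explored G f n i j E) (hn : n ≤ 9) (hG : Subcubic G)
    {a : ℕ} {w : V} (ha : G.Adj (f a) w)
    (hw : ∀ b, (a, b) ∈ E ∨ (b, a) ∈ E → f b ≠ w) : bits (row (matrix E) a) < 3 := by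
  rw [h.bits_eq_ncard hn]
  refine (Set.ncard_lt_ncard ⟨h.image_subset a, fun hs => ?_⟩).trans_le (hG (f a))
  obtain ⟨b, hb, hbw⟩ := hs ha
  exact hw b hb hbw

theorem lt_of_mem_or (h : Explored G f n i j E) {a b : ℕ} (hb : (a, b) ∈ E ∨ (b, a) ∈ E) :
    b < n := by
  rcases hb with hb | hb
  · exact ((h.mem_iff a b).1 hb).2.1
  · have := (h.mem_iff b a).1 hb
    omega

/-- A vertex outside the explored closed set can be added. -/
theorem push_root (h : Explored G f n n j E) {w u : V} (hw : ∀ b < n, f b ≠ w)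
    (hwu : G.Adj w u) : Explored G (Function.update f n w) (n + 1) n (n + 1) E := by
  have hf : ∀ a < n, Function.update f n w a = f a := fun a ha =>
    Function.update_of_ne ha.ne _ _
  refine ⟨injOn_update h.injOn hw, by omega, by omega, fun _ => le_rfl, h.nodup, ?_, ?_, ?_⟩
  · intro a b
    rw [h.mem_iff]
    constructor
    · rintro ⟨hab, hb, -, hadj⟩
      refine ⟨hab, by omega, by omega, ?_⟩
      rwa [hf a (by omega), hf b hb]
    · rintro ⟨hab, hb, -, hadj⟩
      rw [hf a (by omega)] at hadj
      rcases eq_or_ne b n with rfl | hbn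
      · rw [Function.update_self] at hadj
        obtain ⟨b', hb', rfl⟩ := h.closed a (by omega) w hadj
        exact absurd rfl (hw b' hb')
      · rw [hf b (by omega)] at hadj
        exact ⟨hab, by omega, by omega, hadj⟩
  · intro a ha v hv
    rw [hf a ha] at hv
    obtain ⟨b, hb, rfl⟩ := h.closed a ha v hv
    exact ⟨b, by omega, hf b hb⟩
  · intro a ha
    rcases eq_or_ne a n with rfl | han
    · exact ⟨u, by rwa [Function.update_self]⟩
    · rw [hf a (by omega)]
      exact h.exists_adj a (by omega)

/-- A new neighbor of the current vertex can be added. -/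
theorem push_neighbor (h : Explored G f n i n E) {w : V} (hw : ∀ b < n, f b ≠ w)
    (hiw : G.Adj (f i) w) :
    Explored G (Function.update f n w) (n + 1) i (n + 1) ((i, n) :: E) := by
  have hf : ∀ a < n, Function.update f n w a = f a := fun a ha =>
    Function.update_of_ne ha.ne _ _
  have hin := h.lt
  refine ⟨injOn_update h.injOn hw, by omega, by omega, fun _ => le_rfl, ?_, ?_, ?_, ?_⟩
  · refine List.nodup_cons.2 ⟨fun hm => ?_, h.nodup⟩
    have := ((h.mem_iff i n).1 hm).2.1
    omega
  · intro a b
    rw [List.mem_cons, h.mem_iff, Prod.mk.injEq]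
    constructor
    · rintro (⟨rfl, rfl⟩ | ⟨hab, hb, hd, hadj⟩)
      · refine ⟨hin, by omega, by omega, ?_⟩
        rwa [hf _ hin, Function.update_self]
      · refine ⟨hab, by omega, by omega, ?_⟩
        rwa [hf a (by omega), hf b hb]
    · rintro ⟨hab, hb, hd, hadj⟩
      rw [hf a (by omega)] at hadj
      rcases eq_or_ne b n with rfl | hbn
      · rcases hd with hai | hai
        · rw [Function.update_self] at hadj
          obtain ⟨b', hb', rfl⟩ := h.closed a hai w hadj
          exact absurd rfl (hw b' hb')
        · exact .inl ⟨hai.1, rfl⟩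
      · rw [hf b (by omega)] at hadj
        exact .inr ⟨hab, by omega, by omega, hadj⟩
  · intro a ha v hv
    rw [hf a (by omega)] at hv
    obtain ⟨b, hb, rfl⟩ := h.closed a ha v hv
    exact ⟨b, by omega, hf b hb⟩
  · intro a ha
    rcases eq_or_ne a n with rfl | han
    · exact ⟨f i, by rw [Function.update_self]; exact hiw.symm⟩
    · rw [hf a (by omega)]
      exact h.exists_adj a (by omega)

/-- When all its neighbors are known, the exploration leaves the current vertex. -/
theorem close (h : Explored G f n i n E) (hi : ∀ w, G.Adj (f i) w → ∃ b < n, f b = w) :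
    Explored G f n (i + 1) (i + 2) E := by
  have hin := h.lt
  refine ⟨h.injOn, by omega, by omega, by omega, h.nodup, ?_, ?_, h.exists_adj⟩
  · intro a b
    rw [h.mem_iff]
    constructor <;> rintro ⟨hab, hb, hd, hadj⟩ <;> exact ⟨hab, hb, by omega, hadj⟩
  · intro a ha w hw
    rcases Nat.lt_succ_iff_lt_or_eq.1 ha with ha | rfl
    · exact h.closed a ha w hw
    · exact hi w hw

theorem skip (h : Explored G f n i j E) (hin : i < n) (hjn : j ≠ n) (hij : ¬G.Adj (f i) (f j)) :
    Explored G f n i (j + 1) E := by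
  have hj := h.le_of_lt hin
  have hlt := h.lt
  refine ⟨h.injOn, h.le, by omega, by omega, h.nodup, ?_, h.closed, h.exists_adj⟩
  intro a b
  rw [h.mem_iff]
  constructor
  · rintro ⟨hab, hb, hd, hadj⟩
    exact ⟨hab, hb, by omega, hadj⟩
  · rintro ⟨hab, hb, hd, hadj⟩
    refine ⟨hab, hb, ?_, hadj⟩
    by_contra hd'
    obtain ⟨rfl, rfl⟩ : a = i ∧ b = j := by omega
    exact hij hadj

theorem connect (h : Explored G f n i j E) (hin : i < n) (hjn : j ≠ n)
    (hij : G.Adj (f i) (f j)) : Explored G f n i (j + 1) ((i, j) :: E) := by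
  have hj := h.le_of_lt hin
  have hlt := h.lt
  refine ⟨h.injOn, h.le, by omega, by omega, ?_, ?_, h.closed, h.exists_adj⟩
  · refine List.nodup_cons.2 ⟨fun hm => ?_, h.nodup⟩
    have := ((h.mem_iff i j).1 hm).2.2.1
    omega
  · intro a b
    rw [List.mem_cons, h.mem_iff, Prod.mk.injEq]
    constructor
    · rintro (⟨rfl, rfl⟩ | ⟨hab, hb, hd, hadj⟩)
      · exact ⟨hlt, by omega, by omega, hij⟩
      · exact ⟨hab, hb, by omega, hadj⟩
    · rintro ⟨hab, hb, hd, hadj⟩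
      by_cases hd' : a = i ∧ b = j
      · exact .inl hd'
      · exact .inr ⟨hab, hb, by omega, hadj⟩

/-- If the explored set contains all the non-isolated vertices and the search for a coloring
succeeds, the graph has a good coloring. -/
theorem exists_goodColoring [Finite V] (h : Explored G f n n j E) (hn : n ≤ 9) (hG : Subcubic G)
    (hiso : ∀ w u, G.Adj w u → ∃ b < n, f b = w)
    (hc : colorable (matrix E) E
      (lowDegree (matrix E) [0, 1, 2, 3, 4, 5, 6, 7, 8]) = true) :
    ∃ c : Sym2 V → Fin 8, GoodColoring G c := by
  classical
  obtain ⟨c, hc, hp⟩ := exists_coloring_of_colorable h.nodup hc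
  have hlt : ∀ e ∈ E, e.1 < e.2 ∧ e.2 < n ∧ G.Adj (f e.1) (f e.2) := fun e he =>
    have := (h.mem_iff e.1 e.2).1 he
    ⟨this.1, this.2.1, this.2.2.2⟩
  have hinj : ∀ e ∈ E, ∀ e' ∈ E, s(f e.1, f e.2) = s(f e'.1, f e'.2) → e = e' := by
    intro e he e' he' hs
    obtain ⟨h1, h2, -⟩ := hlt e he
    obtain ⟨h3, h4, -⟩ := hlt e' he'
    have hi : ∀ a < n, ∀ b < n, f a = f b → a = b := fun a ha b hb => h.injOn ha hb
    rcases Sym2.eq_iff.1 hs with ⟨h5, h6⟩ | ⟨h5, h6⟩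
    · exact Prod.ext (hi _ (by omega) _ (by omega) h5) (hi _ (by omega) _ (by omega) h6)
    · have := hi _ (by omega) _ (by omega) h5
      have := hi _ (by omega) _ (by omega) h6
      omega
  have hmem : ∀ x y, G.Adj x y → ∃ e ∈ E, s(x, y) = s(f e.1, f e.2) := by
    intro x y hxy
    obtain ⟨a, ha, rfl⟩ := hiso x y hxy
    obtain ⟨b, hb, rfl⟩ := hiso y _ hxy.symm
    rcases lt_trichotomy a b with hab | rfl | hab
    · exact ⟨(a, b), (h.mem_iff a b).2 ⟨hab, hb, by omega, hxy⟩, rfl⟩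
    · exact absurd rfl hxy.ne
    · exact ⟨(b, a), (h.mem_iff b a).2 ⟨hab, ha, by omega, hxy.symm⟩, Sym2.eq_swap⟩
  have hrow : ∀ a < n, ∀ b < n, G.Adj (f a) (f b) → (row (matrix E) a).testBit b = true := by
    intro a ha b hb hab
    rw [h.testBit_row_iff hn (by omega), h.mem_iff, h.mem_iff]
    rcases lt_trichotomy a b with hlt | rfl | hlt
    · exact .inl ⟨hlt, hb, by omega, hab⟩
    · exact absurd rfl hab.ne
    · exact .inr ⟨hlt, ha, by omega, hab.symm⟩
  have hdeg : ∀ a < 9, (lowDegree (matrix E) [0, 1, 2, 3, 4, 5, 6, 7, 8]).testBit a = false →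
      (G.neighborSet (f a)).ncard = 3 := by
    intro a ha hl
    have hm : a ∈ [0, 1, 2, 3, 4, 5, 6, 7, 8] := by
      simp only [List.mem_cons, List.not_mem_nil, or_false]
      omega
    exact le_antisymm (hG _)
      ((three_le_bits_of_not_testBit_lowDegree hm hl).trans (h.bits_le_ncard hn a))
  let R (e e' : ℕ × ℕ) : Prop := c e = c e' →
    (f e.1 ≠ f e'.1 ∧ f e.1 ≠ f e'.2 ∧ f e.2 ≠ f e'.1 ∧ f e.2 ≠ f e'.2) ∧
    (c e ≠ 0 → ¬G.Adj (f e.1) (f e'.1) ∧ ¬G.Adj (f e.1) (f e'.2) ∧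
      ¬G.Adj (f e.2) (f e'.1) ∧ ¬G.Adj (f e.2) (f e'.2))
  have hR : ∀ e ∈ E, ∀ e' ∈ E, e ≠ e' → R e e' := by
    have hsymm : Std.Symm R := ⟨fun e e' hr hc => by
      obtain ⟨⟨h1, h2, h3, h4⟩, h5⟩ := hr hc.symm
      refine ⟨⟨h1.symm, h3.symm, h2.symm, h4.symm⟩, fun h0 => ?_⟩
      simpa only [G.adj_comm, and_left_comm, and_assoc] using h5 (hc ▸ h0)⟩
    have hpR : E.Pairwise R := by
      refine hp.imp_of_mem fun {e e'} he he' hee' hc' => ?_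
      obtain ⟨-, he2, hadj⟩ := hlt e he
      have he1 : e.1 < n := by have := (hlt e he).1; omega
      obtain ⟨-, he2', -⟩ := hlt e' he'
      have he1' : e'.1 < n := by have := (hlt e' he').1; omega
      have hadj_forb : c e ≠ 0 → ∀ v < n, G.Adj (f e.1) (f v) ∨ G.Adj (f e.2) (f v) →
          (forbidden (matrix E) (c e) e).testBit v = true := by
        intro h0 v hv hv'
        rw [forbidden, if_neg h0, Nat.testBit_or, Bool.or_eq_true]
        exact hv'.imp (hrow _ he1 v hv) (hrow _ he2 v hv)
      have hself_forb : ∀ v < n, f e.1 = f v ∨ f e.2 = f v →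
          (forbidden (matrix E) (c e) e).testBit v = true := by
        intro v hv hv'
        by_cases h0 : c e = 0
        · rw [forbidden, if_pos h0, Nat.testBit_or, Bool.or_eq_true, Nat.testBit_two_pow,
            Nat.testBit_two_pow, decide_eq_true_eq, decide_eq_true_eq]
          exact hv'.imp (fun h' => h.injOn he1 hv h') fun h' => h.injOn he2 hv h'
        · refine hadj_forb h0 v hv (hv'.symm.imp (fun h' => ?_) fun h' => ?_)
          · exact h' ▸ hadj
          · exact h' ▸ hadj.symm
      obtain ⟨hf1, hf2⟩ := hee' hc'
      have h1 := hself_forb _ he1'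
      have h2 := hself_forb _ he2'
      have h3 := fun h0 => hadj_forb h0 _ he1'
      have h4 := fun h0 => hadj_forb h0 _ he2'
      simp only [hf1, hf2, Bool.false_eq_true, imp_false, not_or] at h1 h2 h3 h4
      exact ⟨⟨h1.1, h2.1, h1.2, h2.2⟩, fun h0 =>
        ⟨(h3 h0).1, (h4 h0).1, (h3 h0).2, (h4 h0).2⟩⟩
    intro e he e' he' hne
    exact hpR.forall he he' hne
  let col (s : Sym2 V) : Fin 8 :=
    if hs : ∃ e ∈ E, s = s(f e.1, f e.2) then Fin.ofNat 8 (c hs.choose) else 0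
  have hcol : ∀ e ∈ E, (col s(f e.1, f e.2)).val = c e := by
    intro e he
    have hs : ∃ e' ∈ E, s(f e.1, f e.2) = s(f e'.1, f e'.2) := ⟨e, he, rfl⟩
    have : hs.choose = e := (hinj e he _ hs.choose_spec.1 hs.choose_spec.2).symm
    simp only [col, dif_pos hs, this, Fin.val_ofNat]
    exact Nat.mod_eq_of_lt (hc e he).1
  have hcol0 : ∀ e ∈ E, col s(f e.1, f e.2) = 0 ↔ c e = 0 := fun e he => by
    rw [Fin.ext_iff, hcol e he, Fin.val_zero]
  have key : ∀ a b x y, G.Adj a b → G.Adj x y → s(a, b) ≠ s(x, y) →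
      col s(a, b) = col s(x, y) → (a ≠ x ∧ a ≠ y ∧ b ≠ x ∧ b ≠ y) ∧
      (col s(a, b) ≠ 0 → ¬G.Adj a x ∧ ¬G.Adj a y ∧ ¬G.Adj b x ∧ ¬G.Adj b y) := by
    intro a b x y hab hxy hne hcc
    obtain ⟨e, he, hs⟩ := hmem a b hab
    obtain ⟨e', he', hs'⟩ := hmem x y hxy
    rw [hs, hs', Fin.ext_iff, hcol e he, hcol e' he'] at hcc
    rw [hs, (hcol0 e he).ne]
    obtain ⟨h1, h2⟩ := hR e he e' he' (by rintro rfl; exact hne (hs.trans hs'.symm)) hcc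
    rcases Sym2.eq_iff.1 hs with ⟨rfl, rfl⟩ | ⟨rfl, rfl⟩ <;>
      rcases Sym2.eq_iff.1 hs' with ⟨rfl, rfl⟩ | ⟨rfl, rfl⟩ <;>
      exact ⟨by tauto, fun h0 => by have := h2 h0; tauto⟩
  refine ⟨col, ⟨fun a b x y hab hxy hne h0 h0' => ?_, fun a b x y hab hxy hne hcc h0 => ?_⟩,
    fun a b hab h0 => ?_⟩
  · exact (key a b x y hab hxy hne (h0.trans h0'.symm)).1
  · exact ⟨(key a b x y hab hxy hne hcc).1, (key a b x y hab hxy hne hcc).2 h0⟩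
  · obtain ⟨e, he, hs⟩ := hmem a b hab
    rw [hs, hcol0 e he] at h0
    have hce := hc e he
    obtain ⟨h1, h2, -⟩ := hlt e he
    rw [h0, mul_zero, zero_add, zero_add] at hce
    have h3 := hdeg e.1 (by omega) hce.2.1
    have h4 := hdeg e.2 (by omega) hce.2.2
    rcases Sym2.eq_iff.1 hs with ⟨rfl, rfl⟩ | ⟨rfl, rfl⟩
    · exact ⟨h3, h4⟩
    · exact ⟨h4, h3⟩

end Explored

theorem exists_goodColoring_of_search [Finite V] (hG : Subcubic G) (hV : Nat.card V ≤ 9)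
    (hdeg : ∀ v, (G.neighborSet v).ncard ≠ 1) (k : ℕ) (h : Explored G f n i j E)
    (hs : search k n i j E (matrix E) = true) : ∃ c : Sym2 V → Fin 8, GoodColoring G c := by
  induction k generalizing f n i j E with
  | zero => exact absurd hs Bool.false_ne_true
  | succ k ih =>
    have hn : n ≤ 9 := (le_card_of_injOn h.injOn).trans hV
    have hn' : ∀ w, (∀ b < n, f b ≠ w) → Nat.ble 9 n = false := fun w hw => by
      have := (le_card_of_injOn (injOn_update h.injOn hw)).trans hV
      rw [Bool.eq_false_iff, Ne, Nat.ble_eq]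
      omega
    have h3 : ∀ a w, G.Adj (f a) w → (∀ b, (a, b) ∈ E ∨ (b, a) ∈ E → f b ≠ w) →
        Nat.ble 3 (bits (row (matrix E) a)) = false := fun a w ha hw => by
      have := h.bits_lt_of_adj hn hG ha hw
      rw [Bool.eq_false_iff, Ne, Nat.ble_eq]
      omega
    change (bif Nat.beq i n then
        colorable (matrix E) E (lowDegree (matrix E) [0, 1, 2, 3, 4, 5, 6, 7, 8]) &&
          (Nat.ble 9 n || search k (n + 1) i (n + 1) E (matrix E))
      else bif Nat.beq j n then
        (Nat.ble (bits (row (matrix E) i)) 1 || search k n (i + 1) (i + 2) E (matrix E)) &&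
          (Nat.ble 9 n || (Nat.ble 3 (bits (row (matrix E) i)) ||
            search k (n + 1) i (n + 1) ((i, n) :: E) (matrix ((i, n) :: E))))
      else
        search k n i (j + 1) E (matrix E) &&
          (Nat.ble 3 (bits (row (matrix E) i)) || (Nat.ble 3 (bits (row (matrix E) j)) ||
            search k n i (j + 1) ((i, j) :: E) (matrix ((i, j) :: E))))) = true at hs
    rcases eq_or_ne i n with rfl | hin
    · rw [Nat.beq_refl, cond_true, Bool.and_eq_true] at hs
      by_cases hiso : ∀ w u, G.Adj w u → ∃ b < i, f b = w
      · exact h.exists_goodColoring hn hG hiso hs.1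
      · push Not at hiso
        obtain ⟨w, u, hwu, hw⟩ := hiso
        rw [hn' w hw, Bool.false_or] at hs
        exact ih (h.push_root hw hwu) hs.2
    have hlt : i < n := lt_of_le_of_ne h.le hin
    rw [show Nat.beq i n = false by rwa [Bool.eq_false_iff, Ne, Nat.beq_eq], cond_false] at hs
    rcases eq_or_ne j n with rfl | hjn
    · rw [Nat.beq_refl, cond_true, Bool.and_eq_true] at hs
      by_cases hi : ∀ w, G.Adj (f i) w → ∃ b < j, f b = w
      · have h2 : Nat.ble (bits (row (matrix E) i)) 1 = false := by
          have hb : bits (row (matrix E) i) = (G.neighborSet (f i)).ncard := by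
            rw [h.bits_eq_ncard hn]
            refine congrArg _ ((h.image_subset i).antisymm fun w hw => ?_)
            obtain ⟨b, hb, rfl⟩ := hi w hw
            refine ⟨b, ?_, rfl⟩
            rw [Set.mem_ofPred_eq, h.mem_iff, h.mem_iff]
            rcases lt_trichotomy i b with hib | rfl | hib
            · exact .inl ⟨hib, hb, by omega, hw⟩
            · exact absurd rfl (G.ne_of_adj hw)
            · exact .inr ⟨hib, hlt, by omega, G.adj_symm hw⟩
          have h1 := hdeg (f i)
          have h0 : 0 < (G.neighborSet (f i)).ncard := (Set.ncard_pos).2 (h.exists_adj i hlt)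
          rw [Bool.eq_false_iff, Ne, Nat.ble_eq]
          omega
        rw [h2, Bool.false_or] at hs
        exact ih (h.close hi) hs.1
      · push Not at hi
        obtain ⟨w, hiw, hw⟩ := hi
        rw [hn' w hw, h3 i w hiw fun b hb => hw b (h.lt_of_mem_or hb), Bool.false_or,
          Bool.false_or] at hs
        exact ih (h.push_neighbor hw hiw) hs.2
    rw [show Nat.beq j n = false by rwa [Bool.eq_false_iff, Ne, Nat.beq_eq], cond_false, Bool.and_eq_true] at hs
    by_cases hij : G.Adj (f i) (f j)
    · have hj := h.le_of_lt hlt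
      have hlt' := h.lt
      have hne : ∀ a < n, ∀ b, b < n → f b = f a → b = a := fun a ha b hb => h.injOn hb ha
      rw [h3 i (f j) hij fun b hb hbj => ?_, h3 j (f i) hij.symm fun b hb hbi => ?_,
        Bool.false_or, Bool.false_or] at hs
      · exact ih (h.connect hlt hjn hij) hs.2
      · obtain rfl := hne i hlt b (h.lt_of_mem_or hb) hbi
        rw [h.mem_iff, h.mem_iff] at hb
        omega
      · obtain rfl := hne j (by omega) b (h.lt_of_mem_or hb) hbj
        rw [h.mem_iff, h.mem_iff] at hb
        omega
    · exact ih (h.skip hlt hjn hij) hs.1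

/-- A good coloring survives the attachment of a pendant edge `uv`. -/
theorem exists_goodColoring_of_pendant [Finite V] (hG : Subcubic G) {u v : V}
    (hv : G.neighborSet v = {u})
    (hc : ∃ c : Sym2 V → Fin 8, GoodColoring (G.deleteEdges {s(u, v)}) c) :
    ∃ c : Sym2 V → Fin 8, GoodColoring G c := by
  classical
  obtain ⟨c, ⟨hc0, hc2⟩, hc3⟩ := hc
  set H := G.deleteEdges {s(u, v)} with hH
  have hHadj : ∀ x y, H.Adj x y ↔ G.Adj x y ∧ s(x, y) ≠ s(u, v) := by
    simp [hH, SimpleGraph.deleteEdges_adj]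
  have hvu : ∀ x, G.Adj v x ↔ x = u := fun x => by
    rw [← SimpleGraph.mem_neighborSet, hv, Set.mem_singleton_iff]
  have hHv : ∀ x, ¬H.Adj v x := fun x hx => by
    obtain ⟨h1, h2⟩ := (hHadj v x).1 hx
    obtain rfl := (hvu x).1 h1
    exact h2 Sym2.eq_swap
  have huv : G.Adj u v := ((hvu u).2 rfl).symm
  have hsub : ∀ x, H.neighborSet x ⊆ G.neighborSet x := fun x y hy => ((hHadj x y).1 hy).1
  have hHG : Subcubic H := fun x => (Set.ncard_le_ncard (hsub x)).trans (hG x)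
  let near : Finset (Fin 8) := insert 0 ((H.neighborSet u).toFinite.toFinset.biUnion fun x =>
    (H.neighborSet x).toFinite.toFinset.image fun y => c s(x, y))
  have hu2 : (H.neighborSet u).ncard ≤ 2 := by
    have : (H.neighborSet u).ncard < (G.neighborSet u).ncard :=
      Set.ncard_lt_ncard ⟨hsub u, fun h => hHv u (SimpleGraph.Adj.symm (h huv))⟩
    have := hG u
    omega
  have hcard : near.card < 8 := by
    refine (Finset.card_insert_le _ _).trans_lt ?_
    have h1 : ∀ x ∈ (H.neighborSet u).toFinite.toFinset,
        ((H.neighborSet x).toFinite.toFinset.image fun y => c s(x, y)).card ≤ 3 := fun x _ =>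
      Finset.card_image_le.trans (by rw [← Set.ncard_eq_toFinset_card]; exact hHG x)
    have h2 := Finset.card_biUnion_le_card_mul _ _ _ h1
    rw [← Set.ncard_eq_toFinset_card] at h2
    omega
  obtain ⟨k, hk⟩ : ∃ k, k ∉ near := by
    by_contra! hall
    rw [Finset.eq_univ_iff_forall.2 hall] at hcard
    simp at hcard
  simp only [near, Finset.mem_insert, Finset.mem_biUnion, Finset.mem_image,
    Set.Finite.mem_toFinset, SimpleGraph.mem_neighborSet, not_or, not_exists, not_and] at hk
  obtain ⟨hk0, hk⟩ := hk
  have hfar : ∀ x y, H.Adj x y → c s(x, y) = k → x ≠ u ∧ ¬G.Adj u x := by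
    intro x y hxy hck
    refine ⟨?_, fun hux => ?_⟩
    · rintro rfl
      exact hk y hxy x hxy.symm (Sym2.eq_swap ▸ hck)
    · refine hk x ((hHadj u x).2 ⟨hux, fun hs => ?_⟩) y hxy hck
      rcases Sym2.eq_iff.1 hs with ⟨-, rfl⟩ | ⟨rfl, -⟩
      · exact hHv y hxy
      · exact huv.ne rfl
  have hfar' : ∀ x y, H.Adj x y → c s(x, y) = k →
      (u ≠ x ∧ u ≠ y ∧ v ≠ x ∧ v ≠ y) ∧
      ¬G.Adj u x ∧ ¬G.Adj u y ∧ ¬G.Adj v x ∧ ¬G.Adj v y := by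
    intro x y hxy hck
    obtain ⟨h1, h2⟩ := hfar x y hxy hck
    obtain ⟨h3, h4⟩ := hfar y x hxy.symm (Sym2.eq_swap ▸ hck)
    rw [hvu, hvu]
    exact ⟨⟨h1.symm, h3.symm, fun h => hHv y (h ▸ hxy), fun h => hHv x (h ▸ hxy.symm)⟩,
      h2, h4, h1, h3⟩
  have hold : ∀ x y, G.Adj x y → s(x, y) ≠ s(u, v) →
      H.Adj x y ∧ Function.update c s(u, v) k s(x, y) = c s(x, y) := fun x y hxy hne =>
    ⟨(hHadj x y).2 ⟨hxy, hne⟩, Function.update_of_ne hne _ _⟩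
  have hGH : ∀ a b x y, H.Adj a b → H.Adj x y → ¬H.Adj a x → ¬G.Adj a x := by
    intro a b x y hab hxy hax hax'
    refine hax ((hHadj a x).2 ⟨hax', fun hs => ?_⟩)
    rcases Sym2.eq_iff.1 hs with ⟨-, rfl⟩ | ⟨rfl, -⟩
    · exact hHv y hxy
    · exact hHv b hab
  refine ⟨Function.update c s(u, v) k, ⟨?_, ?_⟩, ?_⟩
  · intro a b x y hab hxy hne h0 h0'
    have hne0 : ∀ s, Function.update c s(u, v) k s = 0 → s ≠ s(u, v) := by
      rintro s hs rfl
      exact hk0 (by simpa using hs)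
    obtain ⟨h1, h2⟩ := hold a b hab (hne0 _ h0)
    obtain ⟨h3, h4⟩ := hold x y hxy (hne0 _ h0')
    exact hc0 a b x y h1 h3 hne (h2 ▸ h0) (h4 ▸ h0')
  · intro a b x y hab hxy hne hcc h0
    by_cases hs : s(a, b) = s(u, v)
    · obtain ⟨h1, h2⟩ := hold x y hxy (hs ▸ hne.symm)
      rw [hs, Function.update_self, h2] at hcc
      have := hfar' x y h1 hcc.symm
      rcases Sym2.eq_iff.1 hs with ⟨rfl, rfl⟩ | ⟨rfl, rfl⟩ <;> tauto
    by_cases hs' : s(x, y) = s(u, v)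
    · obtain ⟨h1, h2⟩ := hold a b hab hs
      rw [hs', Function.update_self, h2] at hcc
      have := hfar' a b h1 hcc
      rcases Sym2.eq_iff.1 hs' with ⟨rfl, rfl⟩ | ⟨rfl, rfl⟩ <;>
        simp only [G.adj_comm, ne_comm] at this ⊢ <;> tauto
    · obtain ⟨h1, h2⟩ := hold a b hab hs
      obtain ⟨h3, h4⟩ := hold x y hxy hs'
      rw [h2, h4] at hcc
      obtain ⟨hd, h5, h6, h7, h8⟩ := hc2 a b x y h1 h3 hne hcc (h2 ▸ h0)
      exact ⟨hd, hGH a b x y h1 h3 h5, hGH a b y x h1 h3.symm h6,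
        hGH b a x y h1.symm h3 h7, hGH b a y x h1.symm h3.symm h8⟩
  · intro a b hab h0
    have hs : s(a, b) ≠ s(u, v) := fun hs => hk0 (by rwa [hs, Function.update_self] at h0)
    obtain ⟨h1, h2⟩ := hold a b hab hs
    obtain ⟨h3, h4⟩ := hc3 a b h1 (h2 ▸ h0)
    exact ⟨le_antisymm (hG a) (h3 ▸ Set.ncard_le_ncard (hsub a)),
      le_antisymm (hG b) (h4 ▸ Set.ncard_le_ncard (hsub b))⟩

theorem _root_.MinCounter.ncard_neighborSet_ne_one [Finite V] (hG : MinCounter V G) (v : V) :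
    (G.neighborSet v).ncard ≠ 1 := by
  intro hv
  obtain ⟨hcubic, hnot, hmin⟩ := hG
  obtain ⟨u, hu⟩ := Set.ncard_eq_one.1 hv
  have huv : G.Adj u v :=
    SimpleGraph.Adj.symm ((SimpleGraph.mem_neighborSet G v u).1 (hu ▸ Set.mem_singleton u))
  refine hnot (exists_goodColoring_of_pendant hcubic hu (hmin V _ (fun x => ?_) ?_))
  · refine (Set.ncard_le_ncard fun y hy => ?_).trans (hcubic x)
    exact (SimpleGraph.deleteEdges_le _ : G.deleteEdges {s(u, v)} ≤ G) hy
  · rw [SimpleGraph.edgeSet_deleteEdges]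
    exact Nat.add_lt_add_left (Set.ncard_sdiff_singleton_lt_of_mem
      (show s(u, v) ∈ G.edgeSet from huv)) _

theorem explored_zero (f : ℕ → V) : Explored G f 0 0 1 [] where
  injOn := by simp
  le := le_rfl
  lt := one_pos
  le_of_lt := by simp
  nodup := List.nodup_nil
  mem_iff := by simp
  closed := by simp
  exists_adj := by simp

end SmallSubcubic

/-- A minimal counterexample has at least 10 vertices. -/
theorem minCounter_ten_vertices {V : Type} [Finite V] (G : SimpleGraph V)
    (hG : MinCounter V G) :
    10 ≤ Nat.card V := by
  by_contra! hV
  refine hG.2.1 ?_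
  rcases isEmpty_or_nonempty V with hemp | ⟨⟨v⟩⟩
  · exact ⟨fun _ => 0, ⟨fun a => hemp.elim a, fun a => hemp.elim a⟩, fun a => hemp.elim a⟩
  · exact SmallSubcubic.exists_goodColoring_of_search hG.1 (by omega)
      hG.ncard_neighborSet_ne_one 100 (SmallSubcubic.explored_zero fun _ => v)
      SmallSubcubic.search_eq_true
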